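/- arXiv:2312.14374 — 2 statements merged into one kernel-verified Lean document; each statement's English description precedes it below -/
import Mathlib

section
/- Let θ be a substitution whose domain contains no variable occurring in any of the terms t₁, …, tₙ. Then for every unification problem U, ρ(θ)(ρ(U)) = ρ(θ(U)). -/
inductive FOTerm (F : Type) (V : Type) : Type where
  | var : V → FOTerm F V
  | app : F → List (FOTerm F V) → FOTerm F V

namespace FOTerm

variable {F V : Type}

/-- Application of a substitution to a term. -/
def subst (θ : V → FOTerm F V) : FOTerm F V → FOTerm F V
  | .var x => θ x
  | .app f ts => .app f (ts.attach.map fun ⟨t, _⟩ => subst θ t)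

/-- Replacement `ρ`: replace every occurrence of the nullary symbol `u` by `c(tl)`. -/
def replace [DecidableEq F] (u c : F) (tl : List (FOTerm F V)) : FOTerm F V → FOTerm F V
  | .var x => .var x
  | .app f [] => if f = u then .app c tl else .app f []
  | .app f ts => .app f (ts.attach.map fun ⟨t, _⟩ => replace u c tl t)

/-- Inversion `ι`: replace every outermost subterm headed by `c` by the constant `u`. -/
def invert [DecidableEq F] (u c : F) : FOTerm F V → FOTerm F V
  | .var x => .var x
  | .app f ts => if f = c then .app u [] else .app f (ts.attach.map fun ⟨t, _⟩ => invert u c t)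

/-- The variable `x` occurs in a term. -/
inductive OccursVar (x : V) : FOTerm F V → Prop
  | var : OccursVar x (.var x)
  | app {f : F} {ts : List (FOTerm F V)} {t : FOTerm F V} :
      t ∈ ts → OccursVar x t → OccursVar x (.app f ts)

/-- The function symbol `g` occurs (as head of some subterm) in a term. -/
inductive OccursFn (g : F) : FOTerm F V → Prop
  | head {ts : List (FOTerm F V)} : OccursFn g (.app g ts)
  | arg {f : F} {ts : List (FOTerm F V)} {t : FOTerm F V} :
      t ∈ ts → OccursFn g t → OccursFn g (.app f ts)

/-- The domain of a substitution: the variables it moves. -/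
def domain (θ : V → FOTerm F V) : Set V := {x | θ x ≠ FOTerm.var x}

/-- A substitution is a map from variables to terms moving only finitely many variables. -/
def IsSubst (θ : V → FOTerm F V) : Prop := (domain θ).Finite

/-- `ρ` extended to substitutions. -/
def replaceSubst [DecidableEq F] (u c : F) (tl : List (FOTerm F V))
    (θ : V → FOTerm F V) : V → FOTerm F V := fun x => replace u c tl (θ x)

/-- `ι` extended to substitutions. -/
def invertSubst [DecidableEq F] (u c : F) (θ : V → FOTerm F V) : V → FOTerm F V :=
  fun x => invert u c (θ x)

/-- Apply a term transformation to both components of every pair of a unification problem. -/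
def mapProb (g : FOTerm F V → FOTerm F V) (U : Set (FOTerm F V × FOTerm F V)) :
    Set (FOTerm F V × FOTerm F V) := (fun p => (g p.1, g p.2)) '' U

/-- `θ` unifies the unification problem `U`. -/
def Unifies (θ : V → FOTerm F V) (U : Set (FOTerm F V × FOTerm F V)) : Prop :=
  ∀ p ∈ U, subst θ p.1 = subst θ p.2

/-- `U` is unifiable. -/
def Unifiable (U : Set (FOTerm F V × FOTerm F V)) : Prop :=
  ∃ θ, IsSubst θ ∧ Unifies θ U

end FOTerm

namespace FOTerm

theorem subst_var {F V : Type} (θ : V → FOTerm F V) (x : V) : subst θ (.var x) = θ x := by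
  rw [subst]

theorem subst_app {F V : Type} (θ : V → FOTerm F V) (f : F) (ts : List (FOTerm F V)) :
    subst θ (.app f ts) = .app f (ts.map (subst θ)) := by
  rw [subst]
  congr 1
  exact List.attach_map_val

theorem replace_var {F V : Type} [DecidableEq F] (u c : F) (tl : List (FOTerm F V)) (x : V) :
    replace u c tl (.var x) = .var x := by
  rw [replace]

theorem replace_app_nil {F V : Type} [DecidableEq F] (u c : F) (tl : List (FOTerm F V)) (f : F) :
    replace u c tl (.app f []) = if f = u then .app c tl else .app f [] := by
  rw [replace]

theorem replace_app_of_ne_nil {F V : Type} [DecidableEq F] (u c : F) (tl : List (FOTerm F V))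
    (f : F) {ts : List (FOTerm F V)} (h : ts ≠ []) :
    replace u c tl (.app f ts) = .app f (ts.map (replace u c tl)) := by
  rw [replace]
  · congr 1
    exact List.attach_map_val
  · exact h

/-- A substitution fixing every variable of a term fixes the term. -/
theorem subst_eq_self {F V : Type} {θ : V → FOTerm F V} :
    ∀ s : FOTerm F V, (∀ x, OccursVar x s → θ x = .var x) → subst θ s = s
  | .var x, h => by rw [subst_var, h x .var]
  | .app f ts, h => by
    rw [subst_app]
    congr 1
    refine (List.map_congr_left fun t ht => ?_).trans (List.map_id ts)
    exact subst_eq_self t fun x hx => h x (.app ht hx)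

/-- If `θ` moves no variable of `tl`, then `ρ(θ)(ρ(s)) = ρ(θ(s))`. -/
theorem subst_replaceSubst_replace {F V : Type} [DecidableEq F] (u c : F)
    {tl : List (FOTerm F V)} {θ : V → FOTerm F V}
    (hdom : ∀ x ∈ domain θ, ∀ t ∈ tl, ¬ OccursVar x t) :
    ∀ s : FOTerm F V,
      subst (replaceSubst u c tl θ) (replace u c tl s) = replace u c tl (subst θ s)
  | .var x => by rw [replace_var, subst_var, subst_var, replaceSubst]
  | .app f [] => by
    rw [subst_app, List.map_nil, replace_app_nil]
    split_ifs
    · refine subst_eq_self _ fun x hx => ?_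
      cases hx with
      | app ht hx =>
        have hθx : θ x = .var x := by
          by_contra hne
          exact hdom x hne _ ht hx
        rw [replaceSubst, hθx, replace_var]
    · rw [subst_app, List.map_nil]
  | .app f (a :: ts) => by
    rw [replace_app_of_ne_nil u c tl f (List.cons_ne_nil a ts), subst_app, subst_app,
      replace_app_of_ne_nil u c tl f (by simp), List.map_map, List.map_map]
    congr 1
    exact List.map_congr_left fun t ht => subst_replaceSubst_replace u c hdom t

end FOTerm

/-- Let `θ` be a substitution whose domain contains no variable
occurring in any of the terms `t₁, …, tₙ` (the list `tl`).  Then for every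
unification problem `U`, `ρ(θ)(ρ(U)) = ρ(θ(U))`. -/
theorem replace_subst_distrib_prob {F V : Type} [DecidableEq F]
    (u c : F) (tl : List (FOTerm F V)) (θ : V → FOTerm F V)
    (hθ : FOTerm.IsSubst θ)
    (hdom : ∀ x ∈ FOTerm.domain θ, ∀ t ∈ tl, ¬ FOTerm.OccursVar x t) :
    ∀ U : Set (FOTerm F V × FOTerm F V), U.Finite →
      FOTerm.mapProb (FOTerm.subst (FOTerm.replaceSubst u c tl θ))
          (FOTerm.mapProb (FOTerm.replace u c tl) U)
        = FOTerm.mapProb (FOTerm.replace u c tl)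
            (FOTerm.mapProb (FOTerm.subst θ) U) := by
  intro U _
  simp only [FOTerm.mapProb, Set.image_image, FOTerm.subst_replaceSubst_replace u c hdom]
end

section
/- Let U be a unification problem such that the symbol c does not occur in any term of U and no variable occurring in t₁, …, tₙ occurs in any term of U. If ρ(U) is unifiable, then U is unifiable. -/
namespace FOTerm

/-- On terms free of `c`, inverting an instance of the replacement amounts to instantiating
with the inverted substitution. -/
theorem invert_subst_replace {F V : Type} [DecidableEq F] (u c : F) (tl : List (FOTerm F V))
    (θ : V → FOTerm F V) :
    ∀ s : FOTerm F V, ¬ OccursFn c s →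
      invert u c (subst θ (replace u c tl s)) = subst (invertSubst u c θ) s
  | .var x, _ => by simp [replace, subst, invertSubst]
  | .app f [], hs => by
    have hf : f ≠ c := fun h => hs (h ▸ .head)
    by_cases hu : f = u <;> simp [replace, subst, invert, hu]
    exact fun h => absurd h hf
  | .app f (t :: ts), hs => by
    have hf : f ≠ c := fun h => hs (h ▸ .head)
    have ih : ∀ r ∈ t :: ts,
        invert u c (subst θ (replace u c tl r)) = subst (invertSubst u c θ) r :=
      fun r hr => invert_subst_replace u c tl θ r fun h => hs (.arg hr h)
    simpa [replace, subst, invert, hf] using ih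

theorem IsSubst.invertSubst {F V : Type} [DecidableEq F] (u c : F) {θ : V → FOTerm F V}
    (hθ : IsSubst θ) : IsSubst (invertSubst u c θ) :=
  hθ.subset fun x hx h => hx (by simp [FOTerm.invertSubst, h, invert])

end FOTerm

/-- Let `U` be a unification problem in which the symbol `c`
does not occur and in which no variable occurring in `t₁, …, tₙ` (the list `tl`)
occurs.  If `ρ(U)` is unifiable, then `U` is unifiable. -/
theorem unifiable_of_replace_unifiable {F V : Type} [DecidableEq F]
    (u c : F) (tl : List (FOTerm F V))
    (U : Set (FOTerm F V × FOTerm F V)) (hU : U.Finite)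
    (hc : ∀ p ∈ U, ¬ FOTerm.OccursFn c p.1 ∧ ¬ FOTerm.OccursFn c p.2)
    (hvars : ∀ x : V, (∃ t ∈ tl, FOTerm.OccursVar x t) →
      ∀ p ∈ U, ¬ FOTerm.OccursVar x p.1 ∧ ¬ FOTerm.OccursVar x p.2)
    (hunif : FOTerm.Unifiable (FOTerm.mapProb (FOTerm.replace u c tl) U)) :
    FOTerm.Unifiable U := by
  obtain ⟨θ, hθ, h⟩ := hunif
  refine ⟨FOTerm.invertSubst u c θ, hθ.invertSubst u c, fun p hp => ?_⟩
  rw [← FOTerm.invert_subst_replace u c tl θ p.1 (hc p hp).1,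
    ← FOTerm.invert_subst_replace u c tl θ p.2 (hc p hp).2]
  exact congrArg _ (h _ ⟨p, hp, rfl⟩)
end
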